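/- For every finite alphabet A of size n ≥ 2, every probability distribution p on A, and every integer L ≥ ⌈log₂ n⌉ + 1, there exist a binary prefix code ψ on A that minimizes the expected codeword length under p (i.e., every binary prefix code on A has expected codeword length at least that of ψ) and a binary prefix code C on A such that: (i) |C a| ≤ L for every a ∈ A; (ii) |C a| ≤ |ψ a| + 1 for every a ∈ A; and (iii) |C a| = |ψ a| for every a ∈ A with |ψ a| < L − ⌈log₂ n⌉ − 1. -/

import Mathlib

/-- A binary prefix code on an alphabet `A`: an injective assignment of binary
strings such that no codeword is a prefix of another character's codeword. -/
def IsPrefixCode {A : Type*} (C : A → List Bool) : Prop :=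
  Function.Injective C ∧ ∀ a b : A, a ≠ b → ¬ (C a <+: C b)

/-- Expected codeword length of the code `C` under the distribution `p`. -/
noncomputable def expLen {A : Type*} [Fintype A] (p : A → ℝ) (C : A → List Bool) : ℝ :=
  ∑ a, p a * (C a).length

theorem exists_fixedLength_encoding {A : Type*} [Fintype A] {k : ℕ}
    (h : Fintype.card A ≤ 2 ^ k) :
    ∃ e : A → List Bool, Function.Injective e ∧ ∀ a, (e a).length = k := by
  obtain ⟨f⟩ : Nonempty (A ↪ List.Vector Bool k) :=
    Function.Embedding.nonempty_of_card_le (by simpa [card_vector] using h)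
  exact ⟨fun a => (f a).toList, List.Vector.toList_injective.comp f.injective,
    fun a => (f a).toList_length⟩

theorem isPrefixCode_of_forall_not_prefix {A : Type*} {C : A → List Bool}
    (h : ∀ a b : A, a ≠ b → ¬ (C a <+: C b)) : IsPrefixCode C :=
  ⟨fun a b hab => by_contra fun hne => h a b hne (hab ▸ List.prefix_rfl), h⟩

theorem isPrefixCode_of_fixedLength {A : Type*} {e : A → List Bool} {k : ℕ}
    (he : Function.Injective e) (hk : ∀ a, (e a).length = k) : IsPrefixCode e :=
  ⟨he, fun a b hab hp => hab (he (hp.eq_of_length (by rw [hk, hk])))⟩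

/-- Some prefix code minimizes the expected codeword length: the length vectors of prefix codes
form a subset of the well-quasi-order `A → ℕ`, on which the expected length is monotone. -/
theorem exists_isPrefixCode_expLen_le {A : Type*} [Fintype A] {p : A → ℝ} (hp : ∀ a, 0 ≤ p a)
    (hne : ∃ e : A → List Bool, IsPrefixCode e) :
    ∃ ψ : A → List Bool, IsPrefixCode ψ ∧
      ∀ ψ' : A → List Bool, IsPrefixCode ψ' → expLen p ψ ≤ expLen p ψ' := by
  let f : (A → ℕ) → ℝ := fun l => ∑ a, p a * (l a : ℝ)
  have hf : Monotone f := fun l l' h => Finset.sum_le_sum fun a _ =>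
    mul_le_mul_of_nonneg_left (Nat.cast_le.2 (h a)) (hp a)
  let S : Set (A → ℕ) := {l | ∃ C, IsPrefixCode C ∧ ∀ a, (C a).length = l a}
  have hwf : (f '' S).IsWF :=
    ((Set.isPWO_of_wellQuasiOrderedLE S).image_of_monotone hf).isWF
  obtain ⟨e, he⟩ := hne
  have hmem : ∀ C, IsPrefixCode C → expLen p C ∈ f '' S := fun C hC =>
    ⟨fun a => (C a).length, ⟨C, hC, fun _ => rfl⟩, rfl⟩
  have hS : (f '' S).Nonempty := ⟨_, hmem e he⟩
  obtain ⟨l, ⟨ψ, hψ, hl⟩, hmin⟩ := hwf.min_mem hS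
  refine ⟨ψ, hψ, fun ψ' hψ' => ?_⟩
  have h : expLen p ψ = hwf.min hS := by
    rw [← hmin]
    simp [expLen, f, hl]
  exact h ▸ hwf.min_le hS (hmem ψ' hψ')

/-- The Milidiú–Laber construction: the codewords of length at least `m + 1 + k` are replaced by
words of length exactly `m + 1 + k`, hung next to the subtree rooted at a node of depth `m`, which
moves down by one level. -/
theorem IsPrefixCode.exists_length_le {A : Type*} [Fintype A] {ψ : A → List Bool}
    (hψ : IsPrefixCode ψ) {k : ℕ} (hk : Fintype.card A ≤ 2 ^ k) (m : ℕ) :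
    ∃ C : A → List Bool, IsPrefixCode C ∧ (∀ a, (C a).length ≤ m + 1 + k) ∧
      (∀ a, (C a).length ≤ (ψ a).length + 1) ∧
      (∀ a, (ψ a).length < m → (C a).length = (ψ a).length) := by
  classical
  by_cases hall : ∀ a, (ψ a).length ≤ m + 1 + k
  · exact ⟨ψ, hψ, hall, fun a => Nat.le_succ _, fun a _ => rfl⟩
  push Not at hall
  obtain ⟨a₀, ha₀⟩ := hall
  obtain ⟨e, he, hek⟩ := exists_fixedLength_encoding hk
  obtain ⟨w, hw, hwm⟩ : ∃ w, w <+: ψ a₀ ∧ w.length = m :=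
    ⟨(ψ a₀).take m, List.take_prefix _ _, by rw [List.length_take]; omega⟩
  let C : A → List Bool := fun a =>
    if m + 1 + k ≤ (ψ a).length then w ++ true :: e a
    else if w <+: ψ a then w ++ false :: (ψ a).drop m else ψ a
  have hC : ∀ a, (m + 1 + k ≤ (ψ a).length ∧ C a = w ++ true :: e a) ∨
      ((ψ a).length < m + 1 + k ∧ ∃ s, ψ a = w ++ s ∧ C a = w ++ false :: s) ∨
      ((ψ a).length < m + 1 + k ∧ ¬ w <+: ψ a ∧ C a = ψ a) := by
    intro a
    by_cases h : m + 1 + k ≤ (ψ a).length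
    · exact Or.inl ⟨h, if_pos h⟩
    · by_cases h' : w <+: ψ a
      · obtain ⟨s, hs⟩ := h'
        refine Or.inr (Or.inl ⟨by omega, s, hs.symm, ?_⟩)
        have hdrop : (ψ a).drop m = s := by rw [← hs, ← hwm, List.drop_left]
        simp only [C]
        rw [if_neg h, if_pos ⟨s, hs⟩, hdrop]
      · exact Or.inr (Or.inr ⟨by omega, h', by simp [C, h, h']⟩)
  have hlen : ∀ a, (C a).length ≤ m + 1 + k ∧ (C a).length ≤ (ψ a).length + 1 ∧
      ((ψ a).length < m → (C a).length = (ψ a).length) := by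
    intro a
    rcases hC a with ⟨h, hc⟩ | ⟨h, s, hs, hc⟩ | ⟨h, -, hc⟩
    · simp only [hc, List.length_append, List.length_cons, hek]
      omega
    · have := congrArg List.length hs
      simp only [hc, List.length_append, List.length_cons] at this ⊢
      omega
    · rw [hc]
      omega
  have hout : ∀ a t, (ψ a).length < m + 1 + k → ¬ w <+: ψ a → ¬ ψ a <+: w ++ t := by
    intro a t ha hwa hp
    rcases List.prefix_or_prefix_of_prefix hp (List.prefix_append w t) with h | h
    · exact hψ.2 a a₀ (by rintro rfl; omega) (h.trans hw)
    · exact hwa h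
  refine ⟨C, isPrefixCode_of_forall_not_prefix ?_, fun a => (hlen a).1, fun a => (hlen a).2.1,
    fun a => (hlen a).2.2⟩
  intro a b hab hp
  rcases hC a with ⟨ha, hca⟩ | ⟨ha, s, hs, hca⟩ | ⟨ha, hwa, hca⟩ <;>
  rcases hC b with ⟨hb, hcb⟩ | ⟨hb, t, ht, hcb⟩ | ⟨hb, hwb, hcb⟩ <;>
  rw [hca, hcb] at hp
  · simp only [List.prefix_append_right_inj, List.cons_prefix_cons, true_and] at hp
    exact (isPrefixCode_of_fixedLength he hek).2 a b hab hp
  · simp at hp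
  · exact hwb ((List.prefix_append _ _).trans hp)
  · simp at hp
  · simp only [List.prefix_append_right_inj, List.cons_prefix_cons, true_and] at hp
    exact hψ.2 a b hab (by rwa [hs, ht, List.prefix_append_right_inj])
  · exact hwb ((List.prefix_append _ _).trans hp)
  · exact hout a _ ha hwa hp
  · exact hout a _ ha hwa hp
  · exact hψ.2 a b hab hp

theorem stmt3 {A : Type*} [Fintype A] (n : ℕ) (hn : 2 ≤ n) (hcard : Fintype.card A = n)
    (p : A → ℝ) (hp0 : ∀ a, 0 ≤ p a) (hp1 : ∑ a, p a = 1)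
    (L : ℤ) (hL : ⌈Real.logb 2 n⌉ + 1 ≤ L) :
    ∃ ψ C : A → List Bool, IsPrefixCode ψ ∧ IsPrefixCode C ∧
      (∀ ψ' : A → List Bool, IsPrefixCode ψ' → expLen p ψ ≤ expLen p ψ') ∧
      (∀ a, ((C a).length : ℤ) ≤ L) ∧
      (∀ a, (C a).length ≤ (ψ a).length + 1) ∧
      (∀ a, ((ψ a).length : ℤ) < L - ⌈Real.logb 2 n⌉ - 1 → (C a).length = (ψ a).length) := by
  have hn0 : (0 : ℝ) < n := by exact_mod_cast (by omega : 0 < n)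
  have hlog : 0 ≤ ⌈Real.logb 2 n⌉ :=
    Int.ceil_nonneg (Real.logb_nonneg one_lt_two (by exact_mod_cast (by omega : 1 ≤ n)))
  obtain ⟨k, hk⟩ := Int.eq_ofNat_of_zero_le hlog
  have hcardk : Fintype.card A ≤ 2 ^ k := by
    have h : Real.logb 2 n ≤ (k : ℝ) := by
      simpa [hk] using Int.le_ceil (Real.logb 2 n)
    rw [Real.logb_le_iff_le_rpow one_lt_two hn0, Real.rpow_natCast] at h
    rw [hcard]
    exact_mod_cast h
  obtain ⟨m, hm⟩ := Int.le.dest hL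
  rw [hk] at hm ⊢
  obtain ⟨e, he, hek⟩ := exists_fixedLength_encoding hcardk
  obtain ⟨ψ, hψ, hopt⟩ :=
    exists_isPrefixCode_expLen_le hp0 ⟨e, isPrefixCode_of_fixedLength he hek⟩
  obtain ⟨C, hC, h₁, h₂, h₃⟩ := hψ.exists_length_le hcardk m
  refine ⟨ψ, C, hψ, hC, hopt, fun a => ?_, h₂, fun a ha => h₃ a (by omega)⟩
  have := h₁ a
  omega
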